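/- Let m ≥ 3 be odd and let DA_m = ⟨s,t ∣ π(s,t;m) = π(t,s;m)⟩ be the dihedral Artin group on an edge labeled m. Then the outer automorphism group Out(DA_m) is isomorphic to the cyclic group of order 2. -/

import Mathlib

/-- The alternating product `a * b * a * ⋯` with `n` factors. -/
def altProd {M : Type*} [Monoid M] : M → M → ℕ → M
  | _, _, 0 => 1
  | a, b, n + 1 => a * altProd b a n

/-- The single Artin relation `π(s,t;m) = π(t,s;m)` of the dihedral Artin group `DA_m`,
with `s = true` and `t = false`. -/
def dihedralArtinRels (m : ℕ) : Set (FreeGroup Bool) :=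
  {altProd (FreeGroup.of true) (FreeGroup.of false) m *
    (altProd (FreeGroup.of false) (FreeGroup.of true) m)⁻¹}

/-- The dihedral Artin group `DA_m = ⟨s,t ∣ π(s,t;m) = π(t,s;m)⟩`. -/
abbrev DihedralArtinGroup (m : ℕ) : Type := PresentedGroup (dihedralArtinRels m)

/-- The subgroup of inner automorphisms of a group. -/
def innerAutSubgroup (G : Type*) [Group G] : Subgroup (MulAut G) :=
  (MulAut.conj (G := G)).range

instance innerAutSubgroup_normal (G : Type*) [Group G] : (innerAutSubgroup G).Normal := by
  constructor
  rintro f ⟨g, rfl⟩ φ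
  refine ⟨φ g, ?_⟩
  ext x
  simp only [MulAut.conj_apply, MulAut.mul_apply, MulAut.inv_def, map_mul, map_inv,
    MulEquiv.apply_symm_apply]

/-- The outer automorphism group of a group: the quotient of the automorphism group by the
normal subgroup of inner automorphisms. -/
abbrev Out (G : Type*) [Group G] : Type _ := MulAut G ⧸ innerAutSubgroup G

namespace Monoid.CoprodI

variable {ι : Type*} {G : ι → Type*} [∀ i, Group (G i)]

theorem NeWord.toList_eq_of_prod_eq {i j k l : ι} {v : NeWord G i j} {w : NeWord G k l}
    (h : v.prod = w.prod) : v.toList = w.toList := by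
  classical
  exact congrArg Word.toList (Word.equiv.symm.injective h)

theorem NeWord.head_index_eq_of_prod_eq {i j k l : ι} {v : NeWord G i j} {w : NeWord G k l}
    (h : v.prod = w.prod) : i = k := by
  have hv := v.toList_head?
  rw [NeWord.toList_eq_of_prod_eq h, w.toList_head?] at hv
  exact (congrArg Sigma.fst (Option.some.inj hv)).symm

theorem NeWord.prod_ne_one {i j : ι} (w : NeWord G i j) : w.prod ≠ 1 := by
  classical
  intro h
  have : w.toWord = Word.empty := Word.equiv.symm.injective h
  exact w.toList_ne_nil (congrArg Word.toList this)

theorem NeWord.length_toList_pos {i j : ι} (w : NeWord G i j) : 0 < w.toList.length :=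
  List.length_pos_of_ne_nil w.toList_ne_nil

theorem NeWord.length_toList_inv {i j : ι} (w : NeWord G i j) :
    w.inv.toList.length = w.toList.length := by
  induction w with
  | singleton x hx => rfl
  | append v h w hv hw => simp [NeWord.inv, hv, hw, add_comm]

theorem eq_one_or_exists_neWord (g : CoprodI G) :
    g = 1 ∨ ∃ (i j : ι) (w : NeWord G i j), w.prod = g := by
  classical
  obtain ⟨w, rfl⟩ := Word.equiv.symm.surjective g
  by_cases h : w = Word.empty
  · left; subst h; rfl
  · obtain ⟨i, j, w, rfl⟩ := NeWord.of_word w h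
    exact Or.inr ⟨i, j, w, rfl⟩

theorem NeWord.exists_prod_eq_of_mul {i j : ι} (w : NeWord G i j) :
    (i = j ∧ ∃ a : G i, w.prod = of a) ∨
    ∃ (a : G i) (k : ι) (v : NeWord G k j), k ≠ i ∧ w.prod = of a * v.prod ∧
      v.toList.length < w.toList.length := by
  induction w with
  | singleton x hx => exact Or.inl ⟨rfl, x, by simp⟩
  | @append i j k l u h v hu hv =>
    right
    rcases hu with ⟨rfl, a, ha⟩ | ⟨a, p, u', hp, ha, hl⟩
    · exact ⟨a, k, v, h.symm, by simp [ha], by simpa using u.length_toList_pos⟩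
    · exact ⟨a, p, .append u' h v, hp, by simp [ha, mul_assoc], by simpa using hl⟩

theorem NeWord.exists_prod_eq_mul_of {i j : ι} (w : NeWord G i j) :
    (i = j ∧ ∃ a : G j, w.prod = of a) ∨
    ∃ (a : G j) (k : ι) (v : NeWord G i k), k ≠ j ∧ w.prod = v.prod * of a ∧
      v.toList.length < w.toList.length := by
  rcases w.inv.exists_prod_eq_of_mul with ⟨rfl, a, ha⟩ | ⟨a, k, v, hk, ha, hl⟩
  · refine Or.inl ⟨rfl, a⁻¹, ?_⟩
    rw [map_inv, ← ha, NeWord.inv_prod, inv_inv]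
  · refine Or.inr ⟨a⁻¹, k, v.inv, hk, ?_, ?_⟩
    · rw [map_inv, NeWord.inv_prod, ← mul_inv_rev, ← ha, NeWord.inv_prod, inv_inv]
    · rw [NeWord.length_toList_inv] at *
      exact hl

theorem NeWord.prod_pow_ne_one {i j : ι} (h : i ≠ j) (w : NeWord G i j) {n : ℕ} (hn : n ≠ 0) :
    w.prod ^ n ≠ 1 := by
  obtain ⟨n, rfl⟩ := Nat.exists_eq_succ_of_ne_zero hn
  have : ∃ v : NeWord G i j, v.prod = w.prod ^ (n + 1) := by
    clear hn
    induction n with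
    | zero => exact ⟨w, by simp⟩
    | succ n ih =>
      obtain ⟨v, hv⟩ := ih
      exact ⟨.append v h.symm w, by rw [NeWord.append_prod, hv, pow_succ _ (n + 1)]⟩
  obtain ⟨v, hv⟩ := this
  rw [← hv]
  exact v.prod_ne_one

theorem NeWord.exists_conj_of_of_pow_eq_one {n : ℕ} (hn : n ≠ 0) {i j : ι} (w : NeWord G i j)
    (hw : w.prod ^ n = 1) : ∃ (g : CoprodI G) (k : ι) (a : G k), w.prod = g * of a * g⁻¹ := by
  induction hN : w.toList.length using Nat.strong_induction_on generalizing i j with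
  | _ N ih =>
  subst hN
  by_cases hij : i = j
  · subst hij
    rcases w.exists_prod_eq_of_mul with ⟨-, a, ha⟩ | ⟨a, k, v, hk, ha, hl⟩
    · exact ⟨1, i, a, by simp [ha]⟩
    rcases v.exists_prod_eq_mul_of with ⟨rfl, -⟩ | ⟨c, l, u, hli, hc, hl'⟩
    · exact absurd rfl hk
    have key : w.prod = of a * (u.prod * of (c * a)) * (of a)⁻¹ := by
      rw [ha, hc, map_mul]; group
    have hpow : (u.prod * of (c * a)) ^ n = 1 := by
      rw [key, conj_pow] at hw
      simpa [mul_inv_eq_one] using hw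
    by_cases hca : c * a = 1
    · rw [hca, map_one, mul_one] at key hpow
      obtain ⟨g, p, d, hd⟩ := ih _ (hl'.trans hl) u hpow rfl
      exact ⟨of a * g, p, d, by rw [key, hd]; group⟩
    · refine absurd hpow ?_
      have := NeWord.prod_pow_ne_one hk (.append u hli (.singleton (c * a) hca)) hn
      simpa using this
  · exact absurd hw (NeWord.prod_pow_ne_one hij w hn)

theorem exists_conj_of_of_pow_eq_one {n : ℕ} (hn : n ≠ 0) [Nonempty ι] {g : CoprodI G}
    (hg : g ^ n = 1) : ∃ (h : CoprodI G) (k : ι) (a : G k), g = h * of a * h⁻¹ := by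
  rcases eq_one_or_exists_neWord g with rfl | ⟨i, j, w, rfl⟩
  · exact ⟨1, Classical.arbitrary ι, 1, by simp⟩
  · exact w.exists_conj_of_of_pow_eq_one hn hg

theorem eq_one_of_forall_commute [Nontrivial ι] [∀ i, Nontrivial (G i)] {g : CoprodI G}
    (hg : ∀ h, Commute g h) : g = 1 := by
  rcases eq_one_or_exists_neWord g with rfl | ⟨i, j, w, rfl⟩
  · rfl
  obtain ⟨k, hk⟩ := exists_ne j
  obtain ⟨a, ha⟩ := exists_ne (1 : G k)
  have h : (NeWord.append (.append w hk.symm (.singleton a ha)) hk w.inv).prod =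
      (NeWord.singleton a ha).prod := by
    simp [(hg (of a)).eq]
  have := congrArg List.length (NeWord.toList_eq_of_prod_eq h)
  have hl := w.length_toList_pos
  simp only [NeWord.toList, List.length_append, List.length_singleton] at this
  omega

theorem exists_of_mul_mul_of_eq (g : CoprodI G) {p q : ι} (hpq : ∀ i, i = p ∨ i = q) :
    ∃ (a : G p) (c : G q), of a * g * of c = 1 ∨
      ∃ w : NeWord G q p, w.prod = of a * g * of c := by
  have trim_last : ∀ {j : ι} (w : NeWord G q j), ∃ c : G q, w.prod * of c = 1 ∨
      ∃ v : NeWord G q p, v.prod = w.prod * of c := by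
    intro j w
    rcases hpq j with rfl | rfl
    · exact ⟨1, Or.inr ⟨w, by simp⟩⟩
    rcases w.exists_prod_eq_mul_of with ⟨-, c, hc⟩ | ⟨c, k, v, hk, hc, -⟩
    · exact ⟨c⁻¹, Or.inl (by simp [hc])⟩
    · obtain rfl := (hpq k).resolve_right hk
      exact ⟨c⁻¹, Or.inr ⟨v, by simp [hc]⟩⟩
  rcases eq_one_or_exists_neWord g with rfl | ⟨i, j, w, rfl⟩
  · exact ⟨1, 1, Or.inl (by simp)⟩
  rcases hpq i with rfl | rfl
  · rcases w.exists_prod_eq_of_mul with ⟨-, a, ha⟩ | ⟨a, k, v, hk, ha, -⟩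
    · exact ⟨a⁻¹, 1, Or.inl (by simp [ha])⟩
    · obtain rfl := (hpq k).resolve_left hk
      obtain ⟨c, hc⟩ := trim_last v
      exact ⟨a⁻¹, c, by simpa [ha] using hc⟩
  · obtain ⟨c, hc⟩ := trim_last w
    exact ⟨1, c, by simpa using hc⟩

/-- An endomorphism fixing one of two factors and conjugating the other one by a nonempty reduced
word that does not simplify against either factor is not surjective. -/
theorem not_surjective_of_conj {p q : ι} (hpq : ∀ i, i = p ∨ i = q) (hne : p ≠ q)
    [Nontrivial (G q)] (b : NeWord G q p) (ψ : CoprodI G →* CoprodI G)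
    (hp : ∀ a : G p, ψ (of a) = of a) (hq : ∀ c : G q, ψ (of c) = b.prod * of c * b.prod⁻¹) :
    ¬ Function.Surjective ψ := by
  have image : ∀ {i j : ι} (w : NeWord G i j), ∃ v : NeWord G i j, v.prod = ψ w.prod ∧
      (i = q → 1 < v.toList.length) := by
    intro i j w
    induction w with
    | @singleton i x hx =>
      rcases hpq i with rfl | rfl
      · exact ⟨.singleton x hx, by simp [hp], fun h => absurd h hne⟩
      · refine ⟨.append (.append b hne (.singleton x hx)) hne.symm b.inv, by simp [hq], fun _ => ?_⟩
        have := b.length_toList_pos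
        simp only [NeWord.toList, List.length_append, List.length_singleton]
        omega
    | append v h w hv hw =>
      obtain ⟨v', hv', hl⟩ := hv
      obtain ⟨w', hw', -⟩ := hw
      refine ⟨.append v' h w', by simp [hv', hw'], fun h => ?_⟩
      have := hl h
      simp only [NeWord.toList, List.length_append]
      omega
  intro hsurj
  obtain ⟨c, hc⟩ := exists_ne (1 : G q)
  obtain ⟨g, hg⟩ := hsurj (of c)
  rw [← NeWord.prod_singleton c hc] at hg
  rcases eq_one_or_exists_neWord g with rfl | ⟨i, j, w, rfl⟩
  · rw [map_one] at hg
    exact NeWord.prod_ne_one _ hg.symm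
  obtain ⟨v, hv, hl⟩ := image w
  have hv := hv.trans hg
  have hlen := hl (NeWord.head_index_eq_of_prod_eq hv)
  rw [NeWord.toList_eq_of_prod_eq hv] at hlen
  simp at hlen

end Monoid.CoprodI

theorem altProd_two_mul {M : Type*} [Monoid M] (a b : M) (k : ℕ) :
    altProd a b (2 * k) = (a * b) ^ k := by
  induction k with
  | zero => exact (pow_zero _).symm
  | succ k ih =>
    have : altProd a b (2 * (k + 1)) = a * (b * altProd a b (2 * k)) := rfl
    rw [this, ih, pow_succ', mul_assoc]

theorem altProd_two_mul_add_one {M : Type*} [Monoid M] (a b : M) (k : ℕ) :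
    altProd a b (2 * k + 1) = (a * b) ^ k * a := by
  change a * altProd b a (2 * k) = _
  rw [altProd_two_mul]
  exact ((show SemiconjBy a (b * a) (a * b) by simp [SemiconjBy, mul_assoc]).pow_right k).eq

theorem map_altProd {M N : Type*} [Monoid M] [Monoid N] (f : M →* N) (a b : M) (n : ℕ) :
    f (altProd a b n) = altProd (f a) (f b) n := by
  induction n generalizing a b with
  | zero => exact map_one f
  | succ n ih => simp [altProd, ih]

/-- The homomorphism from `ZMod n` sending the generator to an element with trivial `n`-th
power. -/
def zmodPowersHom {H : Type*} [Group H] (n : ℕ) (h : H) (hn : h ^ n = 1) :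
    Multiplicative (ZMod n) →* H :=
  AddMonoidHom.toMultiplicativeLeft
    (ZMod.lift n ⟨zmultiplesHom (Additive H) (Additive.ofMul h), by
      simp [← ofMul_pow, hn]⟩)

theorem zmodPowersHom_ofAdd_one {H : Type*} [Group H] (n : ℕ) (h : H) (hn : h ^ n = 1) :
    zmodPowersHom n h hn (Multiplicative.ofAdd 1) = h := by
  have := ZMod.lift_coe n (⟨zmultiplesHom (Additive H) (Additive.ofMul h), by
      simp [← ofMul_pow, hn]⟩ : {f : ℤ →+ Additive H // f n = 0}) 1
  rw [Int.cast_one] at this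
  change Additive.toMul (ZMod.lift n _ 1) = h
  rw [this]
  simp

theorem exists_zpow_ofAdd_one {n : ℕ} (a : Multiplicative (ZMod n)) :
    ∃ j : ℤ, a = Multiplicative.ofAdd 1 ^ j := by
  obtain ⟨j, hj⟩ := ZMod.intCast_surjective a.toAdd
  refine ⟨j, ?_⟩
  rw [← ofAdd_zsmul, zsmul_one, hj, ofAdd_toAdd]

namespace DihedralArtinGroup

open Multiplicative Monoid

variable {k : ℕ}

/-- The rotation `y = s t`. -/
def rot (k : ℕ) : DihedralArtinGroup (2 * k + 1) :=
  PresentedGroup.of true * PresentedGroup.of false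

/-- The Garside element `x = π(s, t; 2 k + 1)`. -/
def flip (k : ℕ) : DihedralArtinGroup (2 * k + 1) :=
  rot k ^ k * PresentedGroup.of true

theorem relation : (PresentedGroup.of true * PresentedGroup.of false) ^ k * PresentedGroup.of true =
    ((PresentedGroup.of false * PresentedGroup.of true) ^ k * PresentedGroup.of false :
      DihedralArtinGroup (2 * k + 1)) := by
  have h : PresentedGroup.mk (dihedralArtinRels (2 * k + 1)) _ = 1 :=
    PresentedGroup.one_of_mem rfl
  rw [map_mul, map_inv, map_altProd, map_altProd, mul_inv_eq_one, altProd_two_mul_add_one,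
    altProd_two_mul_add_one] at h
  exact h

theorem flip_sq : flip k ^ 2 = rot k ^ (2 * k + 1) := by
  have hsemi : (PresentedGroup.of true : DihedralArtinGroup (2 * k + 1)) *
      (PresentedGroup.of false * PresentedGroup.of true) ^ k =
      rot k ^ k * PresentedGroup.of true :=
    ((show SemiconjBy _ _ (rot k) by simp [SemiconjBy, rot, mul_assoc]).pow_right k).eq
  calc flip k ^ 2 = rot k ^ k * PresentedGroup.of true *
        ((PresentedGroup.of false * PresentedGroup.of true) ^ k * PresentedGroup.of false) := by
        rw [sq, ← relation]; rfl
    _ = rot k ^ k * (PresentedGroup.of true *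
        (PresentedGroup.of false * PresentedGroup.of true) ^ k) * PresentedGroup.of false := by
        simp only [mul_assoc]
    _ = rot k ^ k * rot k ^ k * rot k := by rw [hsemi]; simp only [mul_assoc, rot]
    _ = rot k ^ (2 * k + 1) := by rw [← pow_add, ← pow_succ]; congr 1; omega

theorem of_true_eq : PresentedGroup.of true = (rot k ^ k)⁻¹ * flip k := by
  simp [flip]

theorem of_false_eq : PresentedGroup.of false = (flip k)⁻¹ * rot k ^ (k + 1) := by
  rw [flip, pow_succ, mul_inv_rev]
  nth_rw 3 [rot]
  group

theorem hom_ext {H : Type*} [Group H] {f g : DihedralArtinGroup (2 * k + 1) →* H}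
    (hflip : f (flip k) = g (flip k)) (hrot : f (rot k) = g (rot k)) : f = g := by
  refine PresentedGroup.ext fun b => ?_
  cases b
  · rw [of_false_eq]; simp [hflip, hrot]
  · rw [of_true_eq]; simp [hflip, hrot]

/-- The homomorphism determined by two elements satisfying `x ^ 2 = y ^ (2 k + 1)`. -/
def lift {H : Type*} [Group H] (x y : H) (h : x ^ 2 = y ^ (2 * k + 1)) :
    DihedralArtinGroup (2 * k + 1) →* H :=
  PresentedGroup.toGroup (f := fun b => cond b ((y ^ k)⁻¹ * x) (x⁻¹ * y ^ (k + 1))) (by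
    rintro r rfl
    rw [map_mul, map_inv, map_altProd, map_altProd, mul_inv_eq_one, altProd_two_mul_add_one,
      altProd_two_mul_add_one]
    simp only [FreeGroup.lift_apply_of, cond_true, cond_false]
    have h₁ : (y ^ k)⁻¹ * x * (x⁻¹ * y ^ (k + 1)) = y := by rw [pow_succ]; group
    have h₂ : x⁻¹ * y ^ (k + 1) * ((y ^ k)⁻¹ * x) = x⁻¹ * y * x⁻¹⁻¹ := by rw [pow_succ']; group
    rw [h₁, h₂, conj_pow, mul_inv_cancel_left, inv_inv]
    calc x = x⁻¹ * x ^ 2 := by rw [sq, inv_mul_cancel_left]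
      _ = x⁻¹ * y ^ k * x * (x⁻¹ * y ^ (k + 1)) := by
        rw [h, two_mul, add_assoc, pow_add]; simp only [mul_assoc, mul_inv_cancel_left])

@[simp]
theorem lift_rot {H : Type*} [Group H] (x y : H) (h : x ^ 2 = y ^ (2 * k + 1)) :
    lift x y h (rot k) = y := by
  simp only [lift, rot, map_mul, PresentedGroup.toGroup.of, cond_true, cond_false]
  rw [pow_succ]; group

@[simp]
theorem lift_flip {H : Type*} [Group H] (x y : H) (h : x ^ 2 = y ^ (2 * k + 1)) :
    lift x y h (flip k) = x := by
  rw [flip, map_mul, map_pow, lift_rot]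
  simp only [lift, PresentedGroup.toGroup.of, cond_true, mul_inv_cancel_left]

theorem commute_flip_sq (g : DihedralArtinGroup (2 * k + 1)) : Commute (flip k ^ 2) g := by
  have h : (MulAut.conj (flip k ^ 2)).toMonoidHom = MonoidHom.id _ := by
    apply hom_ext
    · simp [sq]
    · simp only [MulEquiv.toMonoidHom_eq_coe, MonoidHom.coe_coe, MulAut.conj_apply, flip_sq,
        MonoidHom.id_apply]
      rw [← pow_succ, pow_succ', mul_inv_cancel_right]
  have := DFunLike.congr_fun h g
  exact mul_inv_eq_iff_eq_mul.1 this

/-- The abelianization map, sending both standard generators to `1`. -/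
def degree (k : ℕ) : DihedralArtinGroup (2 * k + 1) →* Multiplicative ℤ :=
  lift (ofAdd (2 * k + 1 : ℤ)) (ofAdd 2) (by
    apply toAdd.injective
    simp only [toAdd_pow, toAdd_ofAdd, nsmul_eq_mul]
    push_cast
    ring)

theorem toAdd_degree_flip : (degree k (flip k)).toAdd = 2 * k + 1 := by rw [degree, lift_flip, toAdd_ofAdd]

theorem toAdd_degree_rot : (degree k (rot k)).toAdd = 2 := by rw [degree, lift_rot, toAdd_ofAdd]

theorem exists_degree_zpow (f : DihedralArtinGroup (2 * k + 1) →* Multiplicative ℤ) :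
    ∃ n : ℤ, ∀ g, (f g).toAdd = n * (degree k g).toAdd := by
  have h : 2 * (f (flip k)).toAdd = (2 * k + 1) * (f (rot k)).toAdd := by
    simpa using congrArg (fun g => (f g).toAdd) (flip_sq (k := k))
  obtain ⟨n, hn⟩ : ∃ n, (f (rot k)).toAdd = 2 * n :=
    ⟨(f (flip k)).toAdd - k * (f (rot k)).toAdd, by linear_combination -h⟩
  refine ⟨n, fun g => ?_⟩
  have hf : f = (zpowGroupHom n).comp (degree k) := by
    apply hom_ext <;> apply toAdd.injective
    · simp only [MonoidHom.comp_apply, zpowGroupHom_apply, toAdd_zpow, toAdd_degree_flip,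
        smul_eq_mul]
      rw [hn] at h
      linarith
    · simp only [MonoidHom.comp_apply, zpowGroupHom_apply, toAdd_zpow, toAdd_degree_rot,
        smul_eq_mul]
      linarith
  simpa using congrArg toAdd (DFunLike.congr_fun hf g)

/-- The cyclic factors of the quotient of the group by its center. -/
abbrev Factor (k : ℕ) (i : Bool) : Type := Multiplicative (ZMod (cond i 2 (2 * k + 1)))

/-- The generator of a cyclic factor. -/
def Factor.gen (k : ℕ) (i : Bool) : Factor k i := ofAdd 1

theorem Factor.gen_pow (i : Bool) : Factor.gen k i ^ (cond i 2 (2 * k + 1)) = 1 := by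
  rw [Factor.gen, ← ofAdd_nsmul, nsmul_one, ZMod.natCast_self, ofAdd_zero]

/-- The projection onto the free product of two cyclic groups. -/
def proj (k : ℕ) : DihedralArtinGroup (2 * k + 1) →* CoprodI (Factor k) :=
  lift (CoprodI.of (Factor.gen k true)) (CoprodI.of (Factor.gen k false)) (by
    rw [← map_pow, ← map_pow]
    exact (congrArg _ (Factor.gen_pow true)).trans
      ((map_one _).trans ((congrArg _ (Factor.gen_pow false)).trans (map_one _)).symm))

/-- The lift to the group of the generator of a cyclic factor. -/
def lifted (k : ℕ) (i : Bool) : DihedralArtinGroup (2 * k + 1) := cond i (flip k) (rot k)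

theorem proj_lifted (i : Bool) : proj k (lifted k i) = CoprodI.of (Factor.gen k i) := by
  cases i <;> simp [proj, lifted]

theorem lifted_pow (i : Bool) : lifted k i ^ (cond i 2 (2 * k + 1)) = flip k ^ 2 := by
  cases i
  · exact flip_sq.symm
  · rfl

theorem proj_flip_sq : proj k (flip k ^ 2) = 1 := by
  rw [← lifted_pow true, map_pow, proj_lifted, ← map_pow, Factor.gen_pow, map_one]

theorem exists_proj_zpow (i : Bool) (a : Factor k i) :
    ∃ j : ℤ, proj k (lifted k i ^ j) = CoprodI.of a := by
  obtain ⟨j, rfl⟩ := exists_zpow_ofAdd_one a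
  exact ⟨j, by rw [map_zpow, proj_lifted, ← map_zpow]; rfl⟩

theorem proj_surjective : Function.Surjective (proj k) := by
  intro g
  induction g using CoprodI.induction_on with
  | one => exact ⟨1, map_one _⟩
  | of i a =>
    obtain ⟨j, hj⟩ := exists_proj_zpow i a
    exact ⟨_, hj⟩
  | mul x y hx hy =>
    obtain ⟨x, rfl⟩ := hx
    obtain ⟨y, rfl⟩ := hy
    exact ⟨x * y, map_mul _ _ _⟩

theorem exists_zpow_of_proj_eq_one {g : DihedralArtinGroup (2 * k + 1)} (hg : proj k g = 1) :
    ∃ n : ℤ, g = (flip k ^ 2) ^ n := by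
  let Z := Subgroup.zpowers (flip k ^ 2)
  have hZ : Z.Normal := ⟨by
    rintro _ ⟨n, rfl⟩ g
    refine ⟨n, ?_⟩
    simp only [((commute_flip_sq g).zpow_left n).symm.eq, mul_inv_cancel_right]⟩
  have hpow (i : Bool) : (QuotientGroup.mk' Z (lifted k i)) ^ (cond i 2 (2 * k + 1)) = 1 := by
    rw [← map_pow, lifted_pow]
    exact (QuotientGroup.eq_one_iff _).2 (Subgroup.mem_zpowers _)
  let back : CoprodI (Factor k) →* _ ⧸ Z := CoprodI.lift fun i => zmodPowersHom _ _ (hpow i)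
  have hback (i : Bool) : back (proj k (lifted k i)) = QuotientGroup.mk' Z (lifted k i) := by
    rw [proj_lifted]
    simp only [back, CoprodI.lift_of]
    exact zmodPowersHom_ofAdd_one _ _ _
  have hcomp : back.comp (proj k) = QuotientGroup.mk' Z := hom_ext (hback true) (hback false)
  have hmem : QuotientGroup.mk' Z g = 1 := by
    rw [← hcomp, MonoidHom.comp_apply, hg, map_one]
  obtain ⟨n, hn⟩ := (QuotientGroup.eq_one_iff g).1 hmem
  exact ⟨n, hn.symm⟩

theorem exists_conj_lifted_zpow {n : ℕ} (hn : n ≠ 0) {g : DihedralArtinGroup (2 * k + 1)}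
    (hg : proj k g ^ n = 1) :
    ∃ (h : DihedralArtinGroup (2 * k + 1)) (i : Bool) (j : ℤ), g = h * lifted k i ^ j * h⁻¹ := by
  obtain ⟨h, i, a, ha⟩ := CoprodI.exists_conj_of_of_pow_eq_one hn hg
  obtain ⟨h, rfl⟩ := proj_surjective h
  obtain ⟨j, hj⟩ := exists_proj_zpow i a
  have : proj k (h⁻¹ * g * h * (lifted k i ^ j)⁻¹) = 1 := by
    simp only [map_mul, map_inv, hj, ha]
    group
  obtain ⟨l, hl⟩ := exists_zpow_of_proj_eq_one this
  refine ⟨h, i, (cond i 2 (2 * k + 1) : ℕ) * l + j, ?_⟩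
  rw [zpow_add, zpow_mul, zpow_natCast, lifted_pow, ← hl]
  group

theorem nontrivial_factor (hk : k ≠ 0) (i : Bool) : Nontrivial (Factor k i) := by
  have : Fact (1 < cond i 2 (2 * k + 1)) := ⟨by cases i <;> simp; omega⟩
  infer_instance

theorem map_flip_sq (hk : k ≠ 0) (φ : MulAut (DihedralArtinGroup (2 * k + 1)))
    (hφ : ∀ g, degree k (φ g) = degree k g) : φ (flip k ^ 2) = flip k ^ 2 := by
  have := nontrivial_factor hk
  have hcentral : proj k (φ (flip k ^ 2)) = 1 := by
    refine CoprodI.eq_one_of_forall_commute fun h => ?_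
    obtain ⟨g, rfl⟩ := proj_surjective h
    obtain ⟨g, rfl⟩ := φ.surjective g
    exact ((commute_flip_sq g).map φ).map (proj k)
  obtain ⟨n, hn⟩ := exists_zpow_of_proj_eq_one hcentral
  have hdeg := congrArg (fun g => (degree k g).toAdd) hn
  simp only [hφ, map_pow, map_zpow, toAdd_pow, toAdd_zpow, toAdd_degree_flip, smul_eq_mul,
    nsmul_eq_mul] at hdeg
  obtain rfl : n = 1 := by
    have : (2 * (2 * (k : ℤ) + 1)) ≠ 0 := by omega
    apply mul_right_cancel₀ this
    push_cast at hdeg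
    linarith
  simpa using hn

theorem exists_map_eq_conj (hk : k ≠ 0) (φ : MulAut (DihedralArtinGroup (2 * k + 1)))
    (hφ : ∀ g, degree k (φ g) = degree k g) (i : Bool) :
    ∃ h, φ (lifted k i) = h * lifted k i * h⁻¹ := by
  have hpow : proj k (φ (lifted k i)) ^ (cond i 2 (2 * k + 1)) = 1 := by
    rw [← map_pow, ← map_pow, lifted_pow, map_flip_sq hk φ hφ, proj_flip_sq]
  obtain ⟨h, i', j, hj⟩ := exists_conj_lifted_zpow (by cases i <;> simp) hpow
  have hdeg := congrArg (fun g => (degree k g).toAdd) hj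
  simp only [hφ, map_mul, map_inv, map_zpow, toAdd_mul, toAdd_inv, toAdd_zpow, smul_eq_mul] at hdeg
  suffices i' = i ∧ j = 1 by
    obtain ⟨rfl, rfl⟩ := this
    exact ⟨h, by simpa using hj⟩
  cases i <;> cases i' <;>
    simp only [lifted, cond_true, cond_false, toAdd_degree_flip, toAdd_degree_rot] at hdeg
  · exact ⟨rfl, by omega⟩
  · exfalso
    have hdvd : (2 * (k : ℤ) + 1) ∣ 2 := ⟨j, by linarith⟩
    have := Int.le_of_dvd two_pos hdvd
    omega
  · omega
  · refine ⟨rfl, ?_⟩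
    have : (2 * (k : ℤ) + 1) ≠ 0 := by omega
    apply mul_right_cancel₀ this
    linarith

theorem exists_eq_conj_of_map_flip (hk : k ≠ 0) (φ : MulAut (DihedralArtinGroup (2 * k + 1)))
    {b : DihedralArtinGroup (2 * k + 1)} (hflip : φ (flip k) = flip k)
    (hrot : φ (rot k) = b * rot k * b⁻¹) : ∃ g, φ = MulAut.conj g := by
  obtain ⟨a, c, h⟩ := CoprodI.exists_of_mul_mul_of_eq (proj k b) (p := true) (q := false)
    (by decide)
  obtain ⟨i, hi⟩ := exists_proj_zpow true a
  obtain ⟨j, hj⟩ := exists_proj_zpow false c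
  change proj k (flip k ^ i) = _ at hi
  change proj k (rot k ^ j) = _ at hj
  rw [← hi, ← hj, ← map_mul, ← map_mul] at h
  set d := flip k ^ i * b * rot k ^ j with hd
  set ψ : MulAut (DihedralArtinGroup (2 * k + 1)) := MulAut.conj (flip k ^ i) * φ with hψ
  have hψflip : ψ (flip k) = flip k := by
    simp only [hψ, MulAut.mul_apply, hflip, MulAut.conj_apply]
    group
  have hψrot : ψ (rot k) = d * rot k * d⁻¹ := by
    simp only [hψ, MulAut.mul_apply, hrot, MulAut.conj_apply, hd]
    group
  rcases h with h | ⟨w, hw⟩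
  · obtain ⟨n, hn⟩ := exists_zpow_of_proj_eq_one h
    rw [hn, ((commute_flip_sq (rot k)).zpow_left n).eq, mul_inv_cancel_right] at hψrot
    have : ψ = 1 := MulEquiv.toMonoidHom_injective (hom_ext hψflip hψrot)
    refine ⟨(flip k ^ i)⁻¹, ?_⟩
    rw [map_inv]
    exact eq_inv_of_mul_eq_one_right this
  · exfalso
    have := nontrivial_factor hk
    let θ : CoprodI (Factor k) →* CoprodI (Factor k) := CoprodI.lift fun i =>
      (cond i (MonoidHom.id _) (MulAut.conj w.prod).toMonoidHom).comp CoprodI.of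
    have hθtrue (a : Factor k true) : θ (CoprodI.of a) = CoprodI.of a := by
      simp [θ, CoprodI.lift_of]
    have hθfalse (c : Factor k false) :
        θ (CoprodI.of c) = w.prod * CoprodI.of c * w.prod⁻¹ := by
      simp [θ, CoprodI.lift_of]
    refine CoprodI.not_surjective_of_conj (p := true) (q := false) (by decide) (by decide)
      w θ hθtrue hθfalse ?_
    have hcomp : θ.comp (proj k) = (proj k).comp ψ.toMonoidHom := by
      apply hom_ext
      · change θ (proj k (lifted k true)) = proj k (ψ (flip k))
        rw [hψflip, proj_lifted, hθtrue, ← proj_lifted]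
        rfl
      · change θ (proj k (lifted k false)) = proj k (ψ (rot k))
        rw [hψrot, proj_lifted, hθfalse, ← proj_lifted, hw, ← map_inv, ← map_mul, ← map_mul]
        rfl
    have hsurj : Function.Surjective (θ.comp (proj k)) := by
      rw [hcomp]
      exact proj_surjective.comp ψ.surjective
    exact Function.Surjective.of_comp hsurj

theorem exists_eq_conj_of_degree (hk : k ≠ 0) (φ : MulAut (DihedralArtinGroup (2 * k + 1)))
    (hφ : ∀ g, degree k (φ g) = degree k g) : ∃ g, φ = MulAut.conj g := by
  obtain ⟨a, ha⟩ := exists_map_eq_conj hk φ hφ true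
  obtain ⟨b, hb⟩ := exists_map_eq_conj hk φ hφ false
  change φ (flip k) = a * flip k * a⁻¹ at ha
  change φ (rot k) = b * rot k * b⁻¹ at hb
  obtain ⟨g, hg⟩ := exists_eq_conj_of_map_flip hk (MulAut.conj a⁻¹ * φ) (b := a⁻¹ * b)
    (by simp only [MulAut.mul_apply, ha, MulAut.conj_apply]; group)
    (by simp only [MulAut.mul_apply, hb, MulAut.conj_apply]; group)
  exact ⟨a * g, by rw [map_mul, ← hg, map_inv, mul_inv_cancel_left]⟩

theorem degree_conj (g h : DihedralArtinGroup (2 * k + 1)) :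
    degree k (MulAut.conj g h) = degree k h := by
  simp

/-- The automorphism inverting both standard generators. -/
def inversion (k : ℕ) : MulAut (DihedralArtinGroup (2 * k + 1)) :=
  have h : (flip k)⁻¹ ^ 2 = (rot k)⁻¹ ^ (2 * k + 1) := by rw [inv_pow, inv_pow, flip_sq]
  have hinv : (lift _ _ h).comp (lift _ _ h) = MonoidHom.id _ := hom_ext (by simp) (by simp)
  MonoidHom.toMulEquiv (lift _ _ h) (lift _ _ h) hinv hinv

theorem degree_inversion (g : DihedralArtinGroup (2 * k + 1)) :
    degree k (inversion k g) = (degree k g)⁻¹ := by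
  have h : (degree k).comp (inversion k).toMonoidHom = (degree k)⁻¹ := by
    apply hom_ext <;> simp [inversion]
  exact DFunLike.congr_fun h g

theorem degree_map (φ : MulAut (DihedralArtinGroup (2 * k + 1))) :
    (∀ g, degree k (φ g) = degree k g) ∨ ∀ g, degree k (φ g) = (degree k g)⁻¹ := by
  obtain ⟨n, hn⟩ := exists_degree_zpow ((degree k).comp φ.toMonoidHom)
  obtain ⟨n', hn'⟩ := exists_degree_zpow ((degree k).comp φ.symm.toMonoidHom)
  have hn (g) : (degree k (φ g)).toAdd = n * (degree k g).toAdd := hn g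
  have hn' (g) : (degree k (φ.symm g)).toAdd = n' * (degree k g).toAdd := hn' g
  have hmul : n * n' = 1 := by
    have h := hn (φ.symm (rot k))
    rw [φ.apply_symm_apply, hn', toAdd_degree_rot] at h
    linarith
  rcases Int.eq_one_or_neg_one_of_mul_eq_one hmul with rfl | rfl
  · exact Or.inl fun g => toAdd.injective (by rw [hn, one_mul])
  · exact Or.inr fun g => toAdd.injective (by rw [hn, toAdd_inv, neg_one_mul])

theorem mem_innerAutSubgroup_iff (hk : k ≠ 0) (φ : MulAut (DihedralArtinGroup (2 * k + 1))) :
    φ ∈ innerAutSubgroup (DihedralArtinGroup (2 * k + 1)) ↔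
      ∀ g, degree k (φ g) = degree k g := by
  constructor
  · rintro ⟨h, rfl⟩ g
    exact degree_conj h g
  · intro hφ
    obtain ⟨g, rfl⟩ := exists_eq_conj_of_degree hk φ hφ
    exact ⟨g, rfl⟩

theorem index_innerAutSubgroup (hk : k ≠ 0) :
    (innerAutSubgroup (DihedralArtinGroup (2 * k + 1))).index = 2 := by
  have hne : ¬ ∀ g, (degree k g)⁻¹ = degree k g := fun h => by
    have := congrArg toAdd (h (rot k))
    rw [toAdd_inv, toAdd_degree_rot] at this
    omega
  refine Subgroup.index_eq_two_iff.2 ⟨inversion k, fun φ => ?_⟩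
  rw [mem_innerAutSubgroup_iff hk, mem_innerAutSubgroup_iff hk]
  rcases degree_map φ with h | h
  · exact Or.inr ⟨h, by simpa only [MulAut.mul_apply, h, degree_inversion] using hne⟩
  · exact Or.inl ⟨by simp [h, degree_inversion], by simpa only [h] using hne⟩

end DihedralArtinGroup

/-- For odd `m ≥ 3`, the outer automorphism group of the dihedral Artin group `DA_m` is
isomorphic to the cyclic group of order 2. -/
theorem out_dihedralArtin_odd (m : ℕ) (hm : 3 ≤ m) (hodd : Odd m) :
    Nonempty (Out (DihedralArtinGroup m) ≃* Multiplicative (ZMod 2)) := by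
  obtain ⟨k, rfl⟩ := hodd
  have : Fact (Nat.Prime 2) := ⟨Nat.prime_two⟩
  exact ⟨mulEquivOfPrimeCardEq (p := 2)
    (DihedralArtinGroup.index_innerAutSubgroup (by omega)) (by simp)⟩
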